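/- Sparse representation adapted to both correlative sparsity and sign symmetries: let f, g₁,…,g_m ∈ ℝ[x₁,…,xₙ] and X = {x ∈ ℝⁿ : g₁(x) ≥ 0, …, g_m(x) ≥ 0}. Assume: (i) there are sets I₁,…,I_p ⊆ {1,…,n} covering {1,…,n} and polynomials f₁,…,f_p with f = f₁ + ⋯ + f_p and f_k ∈ ℝ[x,I_k]; (ii) {1,…,m} is partitioned into J₁,…,J_p with g_j ∈ ℝ[x,I_k] for every j ∈ J_k; (iii) I₁,…,I_p satisfy the running intersection property; (iv) for every k there exist N_k > 0 and j ∈ J_k with g_j = N_k − Σ_{i∈I_k} xᵢ². Let A = supp(f) ∪ supp(g₁) ∪ ⋯ ∪ supp(g_m). If f(x) > 0 for all x ∈ X, then f = Σ_{k=1}^p ( σ_{k,0} + Σ_{j∈J_k} σ_{k,j}·g_j ) for some sums of squares σ_{k,0}, σ_{k,j} ∈ Σ[x,I_k] such that for every k, every j ∈ {0} ∪ J_k, every α ∈ supp(σ_{k,j}) and every sign symmetry s of A, one has sᵀα ≡ 0 (mod 2). -/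

import Mathlib

open MvPolynomial

/-- The running intersection property for a family of finite sets `I 0, …, I (p-1)`:
for every `k < p - 1` there is `l ≤ k` with `I (k+1) ∩ (I 0 ∪ ⋯ ∪ I k) ⊆ I l`. -/
def RIPFinset {α : Type*} [DecidableEq α] {p : ℕ} (I : Fin p → Finset α) : Prop :=
  ∀ (k : ℕ) (hk : k + 1 < p),
    ∃ l : Fin p, (l : ℕ) ≤ k ∧
      I ⟨k + 1, hk⟩ ∩ (Finset.univ.filter (fun j : Fin p => (j : ℕ) ≤ k)).biUnion I ⊆ I l

/-- `q` is a sum of squares of polynomials in the variables indexed by `s` (membership in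
`Σ[x, s]`). -/
def IsSOSSupported {n : ℕ} (s : Set (Fin n)) (q : MvPolynomial (Fin n) ℝ) : Prop :=
  ∃ (t : ℕ) (h : Fin t → MvPolynomial (Fin n) ℝ),
    (∀ i, h i ∈ MvPolynomial.supported ℝ s) ∧ q = ∑ i, h i ^ 2

theorem pow_eq_sum_bernstein {A : Type*} [CommRing A] [Algebra ℝ A] {y z : A} (hyz : y + z = 1)
    {a N : ℕ} (haN : a ≤ N) :
    y ^ a = ∑ k ∈ Finset.range (N + 1), algebraMap ℝ A
      ((k.descFactorial a : ℝ) / N.descFactorial a) * ((N.choose k : A) * (y ^ k * z ^ (N - k))) := by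
  obtain ⟨d, rfl⟩ := Nat.exists_eq_add_of_le haN
  have h1 : y ^ a = y ^ a * (y + z) ^ d := by simp [hyz]
  rw [h1, add_pow, add_assoc, Finset.sum_range_add _ a (d + 1), Finset.mul_sum]
  have h0 : ∑ k ∈ Finset.range a, algebraMap ℝ A
      ((k.descFactorial a : ℝ) / (a + d).descFactorial a) *
        (((a + d).choose k : A) * (y ^ k * z ^ (a + d - k))) = 0 := by
    refine Finset.sum_eq_zero fun k hk => ?_
    rw [Nat.descFactorial_of_lt (Finset.mem_range.1 hk)]
    simp
  rw [h0, zero_add]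
  refine Finset.sum_congr rfl fun j hj => ?_
  have hjd : j ≤ d := by simpa [Nat.lt_succ_iff] using hj
  have key : (((a + j).descFactorial a : ℝ) / (a + d).descFactorial a) * ((a + d).choose (a + j) : ℝ)
      = (d.choose j : ℝ) := by
    have hne : ((a + d).descFactorial a : ℝ) ≠ 0 := by
      exact_mod_cast (Nat.descFactorial_pos.2 (Nat.le_add_right a d)).ne'
    have hnat := Nat.choose_mul (n := a + d) (k := a + j) (s := a) (by omega)
    rw [show a + d - a = d by omega, show a + j - a = j by omega] at hnat
    rw [div_mul_eq_mul_div, div_eq_iff hne, Nat.descFactorial_eq_factorial_mul_choose,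
      Nat.descFactorial_eq_factorial_mul_choose]
    have hr : ((a + d).choose (a + j) : ℝ) * ((a + j).choose a) = (a + d).choose a * d.choose j := by
      exact_mod_cast hnat
    push_cast
    linear_combination (a.factorial : ℝ) * hr
  have key' := congrArg (algebraMap ℝ A) key
  rw [map_mul, map_natCast, map_natCast] at key'
  rw [← mul_assoc (algebraMap ℝ A _), key', show a + d - (a + j) = d - j by omega]
  ring

theorem descFactorial_ratio_mem_Icc {k N : ℕ} (a : ℕ) (hk : k ≤ N) :
    (k.descFactorial a : ℝ) / N.descFactorial a ∈ Set.Icc (0 : ℝ) 1 := by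
  refine ⟨by positivity, div_le_one_of_le₀ ?_ (by positivity)⟩
  exact_mod_cast Nat.descFactorial_le a hk

theorem abs_descFactorial_ratio_sub_pow_le (a : ℕ) {k N : ℕ} (hk : k ≤ N) (haN : a < N) :
    |(k.descFactorial a : ℝ) / N.descFactorial a - ((k : ℝ) / N) ^ a| ≤ (a : ℝ) ^ 2 / (N - a) := by
  induction a with
  | zero => simp
  | succ a ih =>
    have hN : (0 : ℝ) < N := by exact_mod_cast (by omega : 0 < N)
    have haN' : ((a + 1 : ℕ) : ℝ) < N := by exact_mod_cast haN
    push_cast at haN'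
    have hNa : (0 : ℝ) < N - a := by linarith
    have hkN : (k : ℝ) ≤ N := by exact_mod_cast hk
    have hstep : |((k - a : ℕ) : ℝ) / ((N - a : ℕ) : ℝ) - (k : ℝ) / N| ≤ a / (N - a) := by
      rw [Nat.cast_sub (by omega : a ≤ N)]
      rcases le_total a k with h | h
      · rw [Nat.cast_sub h, div_sub_div _ _ hNa.ne' hN.ne',
          show ((k : ℝ) - a) * N - (N - a) * k = -(a * (N - k)) by ring, abs_div, abs_neg,
          abs_of_nonneg (by have : (0:ℝ) ≤ N - k := by linarith
                            positivity), abs_of_pos (by positivity),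
          div_le_div_iff₀ (by positivity) hNa]
        have : (a : ℝ) * (N - k) ≤ a * N := by
          apply mul_le_mul_of_nonneg_left _ (Nat.cast_nonneg a)
          linarith [(Nat.cast_nonneg k : (0 : ℝ) ≤ k)]
        nlinarith
      · rw [Nat.sub_eq_zero_of_le h]
        simp only [Nat.cast_zero, zero_div, zero_sub, abs_neg]
        rw [abs_of_nonneg (by positivity)]
        have : (k : ℝ) ≤ a := by exact_mod_cast h
        have ha : (0 : ℝ) ≤ a := by positivity
        gcongr
        linarith
    have hu := descFactorial_ratio_mem_Icc a hk
    have hx : (k : ℝ) / N ∈ Set.Icc (0 : ℝ) 1 := ⟨by positivity, div_le_one_of_le₀ hkN hN.le⟩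
    have ih' := ih (by omega)
    rw [Nat.descFactorial_succ, Nat.descFactorial_succ, pow_succ]
    push_cast
    rw [mul_div_mul_comm]
    set u := (k.descFactorial a : ℝ) / N.descFactorial a
    set x := (k : ℝ) / N
    set v := ((k - a : ℕ) : ℝ) / ((N - a : ℕ) : ℝ)
    have h1 : v * u - x ^ a * x = (v - x) * u + (u - x ^ a) * x := by ring
    rw [h1]
    calc |(v - x) * u + (u - x ^ a) * x| ≤ |(v - x) * u| + |(u - x ^ a) * x| := abs_add_le _ _
      _ = |v - x| * u + |u - x ^ a| * x := by
        rw [abs_mul, abs_mul, abs_of_nonneg hu.1, abs_of_nonneg hx.1]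
      _ ≤ |v - x| * 1 + |u - x ^ a| * 1 := by
        gcongr
        exacts [hu.2, hx.2]
      _ ≤ a / (N - a) + a ^ 2 / (N - a) := by rw [mul_one, mul_one]; exact add_le_add hstep ih'
      _ = (a + a ^ 2) / (N - a) := by ring
      _ ≤ (a + 1) ^ 2 / (N - (a + 1)) := by
        have : (0 : ℝ) ≤ a := by positivity
        have : (0 : ℝ) < N - (a + 1) := by linarith
        gcongr
        · nlinarith
        · linarith

theorem abs_prod_sub_prod_le {ι : Type*} (t : Finset ι) (u v : ι → ℝ)
    (hu : ∀ i ∈ t, u i ∈ Set.Icc (0 : ℝ) 1) (hv : ∀ i ∈ t, v i ∈ Set.Icc (0 : ℝ) 1) :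
    |∏ i ∈ t, u i - ∏ i ∈ t, v i| ≤ ∑ i ∈ t, |u i - v i| := by
  classical
  induction t using Finset.induction_on with
  | empty => simp
  | insert i t hi ih =>
    rw [Finset.prod_insert hi, Finset.prod_insert hi, Finset.sum_insert hi]
    have hu' := hu i (Finset.mem_insert_self _ _)
    have ih' := ih (fun j hj => hu j (Finset.mem_insert_of_mem hj))
      (fun j hj => hv j (Finset.mem_insert_of_mem hj))
    have hp0 : 0 ≤ ∏ j ∈ t, v j :=
      Finset.prod_nonneg fun j hj => (hv j (Finset.mem_insert_of_mem hj)).1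
    have hp1 : ∏ j ∈ t, v j ≤ 1 := Finset.prod_le_one
      (fun j hj => (hv j (Finset.mem_insert_of_mem hj)).1)
      (fun j hj => (hv j (Finset.mem_insert_of_mem hj)).2)
    calc |u i * ∏ j ∈ t, u j - v i * ∏ j ∈ t, v j|
        = |(u i - v i) * ∏ j ∈ t, v j + u i * (∏ j ∈ t, u j - ∏ j ∈ t, v j)| := by ring_nf
      _ ≤ |u i - v i| * ∏ j ∈ t, v j + u i * |∏ j ∈ t, u j - ∏ j ∈ t, v j| := by
        refine (abs_add_le _ _).trans_eq ?_
        rw [abs_mul, abs_mul, abs_of_nonneg hp0, abs_of_nonneg hu'.1]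
      _ ≤ |u i - v i| * 1 + 1 * |∏ j ∈ t, u j - ∏ j ∈ t, v j| := by
        gcongr
        exact hu'.2
      _ ≤ _ := by rw [mul_one, one_mul]; gcongr

/-- The coefficients of a polynomial in the tensor Bernstein basis of degree `N`. -/
noncomputable def bernsteinCoeff {ι : Type*} [Fintype ι] (P : MvPolynomial ι ℝ) (N : ℕ)
    (k : ι → ℕ) : ℝ :=
  ∑ α ∈ P.support, P.coeff α * ∏ i, (((k i).descFactorial (α i) : ℝ) / N.descFactorial (α i))

theorem eq_sum_bernsteinCoeff {ι : Type*} [Fintype ι] [DecidableEq ι] (P : MvPolynomial ι ℝ)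
    {N : ℕ} (hN : ∀ α ∈ P.support, ∀ i, α i ≤ N) :
    P = ∑ k ∈ Fintype.piFinset fun _ : ι => Finset.range (N + 1), C (bernsteinCoeff P N k) *
      ∏ i, ((N.choose (k i) : MvPolynomial ι ℝ) * (X i ^ k i * (1 - X i) ^ (N - k i))) := by
  conv_lhs => rw [P.as_sum]
  simp only [bernsteinCoeff, map_sum, Finset.sum_mul]
  rw [Finset.sum_comm]
  refine Finset.sum_congr rfl fun α hα => ?_
  rw [monomial_eq, Finsupp.prod_fintype _ _ (fun i => pow_zero _)]
  have h (i : ι) := pow_eq_sum_bernstein (y := (X i : MvPolynomial ι ℝ)) (z := 1 - X i)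
    (by ring) (hN α hα i)
  rw [Finset.prod_congr rfl fun i _ => h i, Finset.prod_univ_sum, Finset.mul_sum]
  refine Finset.sum_congr rfl fun k _ => ?_
  rw [map_mul, map_prod, mul_assoc, Finset.prod_mul_distrib]
  rfl

theorem exists_bernsteinCoeff_near {ι : Type*} [Fintype ι] (P : MvPolynomial ι ℝ)
    {ε : ℝ} (hε : 0 < ε) : ∃ N : ℕ, 0 < N ∧ (∀ α ∈ P.support, ∀ i, α i ≤ N) ∧
      ∀ k : ι → ℕ, (∀ i, k i ≤ N) →
        |bernsteinCoeff P N k - eval (fun i => (k i : ℝ) / N) P| < ε := by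
  have hlim : Filter.Tendsto (fun N : ℕ => ∑ α ∈ P.support, |P.coeff α| *
      ∑ i, (α i : ℝ) ^ 2 / (N - α i)) Filter.atTop (nhds 0) := by
    rw [← Finset.sum_const_zero (s := P.support)]
    refine tendsto_finsetSum _ fun α _ => ?_
    rw [← mul_zero |P.coeff α|]
    refine Filter.Tendsto.const_mul _ ?_
    rw [← Finset.sum_const_zero (s := (Finset.univ : Finset ι))]
    refine tendsto_finsetSum _ fun i _ => ?_
    refine Filter.Tendsto.const_div_atTop ?_ _
    exact Filter.tendsto_atTop_add_const_right _ _ tendsto_natCast_atTop_atTop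
  have hev := (hlim.eventually_lt_const hε).and ((Filter.eventually_gt_atTop
    (∑ α ∈ P.support, ∑ i, α i)))
  obtain ⟨N, hN, hbig⟩ := hev.exists
  have hdeg : ∀ α ∈ P.support, ∀ i, α i < N := fun α hα i =>
    ((Finset.single_le_sum (f := fun i => α i) (fun _ _ => Nat.zero_le _)
      (Finset.mem_univ i)).trans (Finset.single_le_sum (f := fun α : ι →₀ ℕ => ∑ i, α i)
        (fun _ _ => Nat.zero_le _) hα)).trans_lt hbig
  refine ⟨N, by omega, fun α hα i => (hdeg α hα i).le, fun k hk => lt_of_le_of_lt ?_ hN⟩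
  rw [eval_eq', bernsteinCoeff, ← Finset.sum_sub_distrib]
  refine (Finset.abs_sum_le_sum_abs _ _).trans (Finset.sum_le_sum fun α hα => ?_)
  rw [← mul_sub, abs_mul]
  refine mul_le_mul_of_nonneg_left ?_ (abs_nonneg _)
  refine (abs_prod_sub_prod_le _ _ _ (fun i _ => descFactorial_ratio_mem_Icc _ (hk i))
    (fun i _ => ?_)).trans (Finset.sum_le_sum fun i _ =>
      abs_descFactorial_ratio_sub_pow_le _ (hk i) (hdeg α hα i))
  have : (k i : ℝ) ≤ N := by exact_mod_cast hk i
  exact ⟨by positivity, pow_le_one₀ (by positivity) (div_le_one_of_le₀ this (by positivity))⟩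

theorem mem_subsemiring_of_pos_on_unitCube {ι : Type*} [Fintype ι]
    {A : Type*} [CommRing A] [Algebra ℝ A] (S : Subsemiring A)
    (hC : ∀ c : ℝ, 0 ≤ c → algebraMap ℝ A c ∈ S) (v : ι → A) (hv : ∀ i, v i ∈ S)
    (hv' : ∀ i, 1 - v i ∈ S) (P : MvPolynomial ι ℝ)
    (hP : ∀ x : ι → ℝ, (∀ i, x i ∈ Set.Icc (0 : ℝ) 1) → 0 < eval x P) : aeval v P ∈ S := by
  classical
  have hcomp : IsCompact (Set.univ.pi fun _ : ι => Set.Icc (0 : ℝ) 1) :=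
    isCompact_univ_pi fun _ => isCompact_Icc
  obtain ⟨x₀, hx₀, hmin⟩ := hcomp.exists_isMinOn ⟨fun _ => 0, fun i _ => by simp⟩
    (P.continuous_eval).continuousOn
  obtain ⟨N, hN0, hdeg, hN⟩ := exists_bernsteinCoeff_near P (hP x₀ fun i => hx₀ i (Set.mem_univ i))
  rw [eq_sum_bernsteinCoeff P hdeg]
  simp only [map_sum, map_mul, map_prod, map_pow, map_sub, map_one, map_natCast, aeval_X, algHom_C]
  refine sum_mem fun k hk => mul_mem (hC _ ?_) (prod_mem fun i _ => mul_mem (natCast_mem _ _)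
    (mul_mem (pow_mem (hv i) _) (pow_mem (hv' i) _)))
  have hk' : ∀ i, k i ≤ N := by simpa [Nat.lt_succ_iff] using hk
  have h1 := hmin (a := fun i => (k i : ℝ) / N) (by
    intro i _
    have : (k i : ℝ) ≤ N := by exact_mod_cast hk' i
    exact ⟨by positivity, div_le_one_of_le₀ this (by positivity)⟩)
  have h2 := (abs_lt.1 (hN k hk')).1
  simp only [Set.mem_ofPred_eq] at h1
  linarith

namespace IsSOSSupported

variable {n : ℕ} {s : Set (Fin n)} {q r : MvPolynomial (Fin n) ℝ}

theorem of_fintype {ι : Type*} [Fintype ι] (h : ι → MvPolynomial (Fin n) ℝ)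
    (hs : ∀ i, h i ∈ supported ℝ s) : IsSOSSupported s (∑ i, h i ^ 2) :=
  ⟨Fintype.card ι, fun i => h ((Fintype.equivFin ι).symm i), fun _ => hs _,
    (Equiv.sum_comp (Fintype.equivFin ι).symm (fun i => h i ^ 2)).symm⟩

theorem zero : IsSOSSupported s (0 : MvPolynomial (Fin n) ℝ) := ⟨0, 0, by simp, by simp⟩

theorem sq (hq : q ∈ supported ℝ s) : IsSOSSupported s (q ^ 2) := by
  simpa using of_fintype (ι := Unit) (fun _ => q) (fun _ => hq)

theorem add (hq : IsSOSSupported s q) (hr : IsSOSSupported s r) : IsSOSSupported s (q + r) := by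
  obtain ⟨t, h, hs, rfl⟩ := hq
  obtain ⟨t', h', hs', rfl⟩ := hr
  simpa using of_fintype (Sum.elim h h') (by rintro (i | i) <;> simp [hs, hs'])

theorem mul (hq : IsSOSSupported s q) (hr : IsSOSSupported s r) : IsSOSSupported s (q * r) := by
  obtain ⟨t, h, hs, rfl⟩ := hq
  obtain ⟨t', h', hs', rfl⟩ := hr
  have := of_fintype (s := s) (fun i : Fin t × Fin t' => h i.1 * h' i.2)
    (fun i => mul_mem (hs _) (hs' _))
  simpa [Fintype.sum_prod_type, Finset.sum_mul_sum, mul_pow] using this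

theorem const {c : ℝ} (hc : 0 ≤ c) : IsSOSSupported s (C c : MvPolynomial (Fin n) ℝ) := by
  have := sq (s := s) (q := C (√c)) (Subalgebra.algebraMap_mem _ _)
  rwa [← C_pow, Real.sq_sqrt hc] at this

theorem sum {ι : Type*} {t : Finset ι} {h : ι → MvPolynomial (Fin n) ℝ}
    (hh : ∀ i ∈ t, IsSOSSupported s (h i)) : IsSOSSupported s (∑ i ∈ t, h i) :=
  Finset.sum_induction _ _ (fun _ _ => add) zero hh

theorem map (φ : MvPolynomial (Fin n) ℝ →ₐ[ℝ] MvPolynomial (Fin n) ℝ)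
    (hφ : ∀ i ∈ s, φ (X i) ∈ supported ℝ s) (hq : IsSOSSupported s q) :
    IsSOSSupported s (φ q) := by
  obtain ⟨t, h, hs, rfl⟩ := hq
  have hle : supported ℝ s ≤ (supported ℝ s).comap φ := by
    refine Algebra.adjoin_le ?_
    rintro _ ⟨i, hi, rfl⟩
    exact hφ i hi
  simpa using of_fintype (fun i => φ (h i)) (fun i => hle (hs i))

end IsSOSSupported

/-- The quadratic module of `ℝ[x, s]` generated by a single polynomial `g`; as it has only one
generator, it is closed under multiplication. -/
def singleQuadraticModule {n : ℕ} (s : Set (Fin n)) (g : MvPolynomial (Fin n) ℝ)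
    (hg : g ∈ supported ℝ s) : Subsemiring (MvPolynomial (Fin n) ℝ) where
  carrier := {q | ∃ a b, IsSOSSupported s a ∧ IsSOSSupported s b ∧ q = a + b * g}
  zero_mem' := ⟨0, 0, .zero, .zero, by simp⟩
  one_mem' := ⟨C 1, 0, .const zero_le_one, .zero, by simp⟩
  add_mem' := by
    rintro _ _ ⟨a, b, ha, hb, rfl⟩ ⟨c, d, hc, hd, rfl⟩
    exact ⟨a + c, b + d, ha.add hc, hb.add hd, by ring⟩
  mul_mem' := by
    rintro _ _ ⟨a, b, ha, hb, rfl⟩ ⟨c, d, hc, hd, rfl⟩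
    exact ⟨a * c + b * d * g ^ 2, a * d + b * c, (ha.mul hc).add ((hb.mul hd).mul (.sq hg)),
      (ha.mul hd).add (hb.mul hc), by ring⟩

theorem eval_aeval_comp {ι κ : Type*} (x : κ → ℝ) (w : ι → MvPolynomial κ ℝ)
    (h : MvPolynomial ι ℝ) : eval x (aeval w h) = eval (fun i => eval x (w i)) h := by
  induction h using MvPolynomial.induction_on with
  | C a => rw [algHom_C, algebraMap_eq, eval_C, eval_C]
  | add p q hp hq => rw [map_add, map_add, map_add, hp, hq]
  | mul_X p i hp => rw [map_mul, map_mul, map_mul, hp, aeval_X, eval_X]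

theorem aeval_eq_self_of_mem_supported {ι : Type*} {s : Set ι} {h : MvPolynomial ι ℝ}
    (hh : h ∈ supported ℝ s) {v : ι → MvPolynomial ι ℝ} (hv : ∀ i ∈ s, v i = X i) :
    aeval v h = h := by
  refine (eval₂Hom_congr' (g₂ := X) rfl (fun i hi _ => hv i (mem_supported.1 hh hi)) rfl).trans ?_
  exact aeval_X_left_apply h

theorem eval_congr_of_mem_supported {ι : Type*} {s : Set ι} {h : MvPolynomial ι ℝ}
    (hh : h ∈ supported ℝ s) {x y : ι → ℝ} (hxy : ∀ i ∈ s, x i = y i) : eval x h = eval y h :=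
  eval₂Hom_congr' rfl (fun i hi _ => hxy i (mem_supported.1 hh hi)) rfl

theorem exists_ball_representation {n : ℕ} (I : Finset (Fin n)) {R N : ℝ} (hR : 0 < R)
    (hNR : N ≤ R ^ 2) {h : MvPolynomial (Fin n) ℝ} (hh : h ∈ supported ℝ (I : Set (Fin n)))
    (hpos : ∀ x : Fin n → ℝ, (∀ i, x i ∈ Set.Icc (-R) R) → 0 < eval x h) :
    ∃ a b, IsSOSSupported (I : Set (Fin n)) a ∧ IsSOSSupported (I : Set (Fin n)) b ∧
      h = a + b * (C N - ∑ i ∈ I, X i ^ 2) := by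
  have hXs : ∀ i ∈ I, (X i : MvPolynomial (Fin n) ℝ) ∈ supported ℝ (I : Set (Fin n)) :=
    fun i hi => X_mem_supported.2 (by simpa using hi)
  have hCs : ∀ c : ℝ, (C c : MvPolynomial (Fin n) ℝ) ∈ supported ℝ (I : Set (Fin n)) :=
    fun c => Subalgebra.algebraMap_mem _ c
  have hg : (C N - ∑ i ∈ I, X i ^ 2 : MvPolynomial (Fin n) ℝ) ∈ supported ℝ (I : Set (Fin n)) :=
    sub_mem (hCs _) (sum_mem fun i hi => pow_mem (hXs i hi) _)
  let T := singleQuadraticModule (I : Set (Fin n)) _ hg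
  have hTs : ∀ {q}, IsSOSSupported (I : Set (Fin n)) q → q ∈ T :=
    fun hq => ⟨_, 0, hq, .zero, by simp⟩
  have hTC : ∀ c : ℝ, 0 ≤ c → C c ∈ T := fun c hc => hTs (.const hc)
  have hTsq : ∀ i ∈ I, (C (R ^ 2) - X i ^ 2 : MvPolynomial (Fin n) ℝ) ∈ T := by
    intro i hi
    refine ⟨C (R ^ 2 - N) + ∑ j ∈ I.erase i, X j ^ 2, C 1, ?_, .const zero_le_one, ?_⟩
    · exact (IsSOSSupported.const (by linarith)).add
        (.sum fun j hj => .sq (hXs j (Finset.mem_of_mem_erase hj)))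
    · rw [← Finset.sum_erase_add _ _ hi, C_1, C_sub]
      ring
  have hlin : ∀ i ∈ I, ∀ e : ℝ, e ^ 2 = 1 →
      (C (1 / (2 * R)) * (C R + C e * X i) : MvPolynomial (Fin n) ℝ) ∈ T := by
    intro i hi e he
    have h1 : (C (1 / (2 * R)) * (C R + C e * X i) : MvPolynomial (Fin n) ℝ) =
        C ((1 / (2 * R)) ^ 2) * ((C R + C e * X i) ^ 2 + (C (R ^ 2) - X i ^ 2)) := by
      have h2 : (C (1 / (2 * R)) ^ 2 * (2 * C R) : MvPolynomial (Fin n) ℝ) = C (1 / (2 * R)) := by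
        have h3 : (1 / (2 * R)) ^ 2 * (2 * R) = 1 / (2 * R) := by field_simp
        have h4 := congrArg (C (σ := Fin n)) h3
        rwa [C_mul, C_mul, C_pow] at h4
      have he' : (C e : MvPolynomial (Fin n) ℝ) ^ 2 = 1 := by rw [← C_pow, he, C_1]
      rw [C_pow, C_pow]
      linear_combination (-C (1 / (2 * R)) ^ 2 * X i ^ 2 : MvPolynomial (Fin n) ℝ) * he' -
        (C R + C e * X i) * h2
    rw [h1]
    exact mul_mem (hTC _ (by positivity)) (add_mem
      (hTs (.sq (add_mem (hCs _) (mul_mem (hCs _) (hXs i hi))))) (hTsq i hi))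
  let v : Fin n → MvPolynomial (Fin n) ℝ :=
    fun i => if i ∈ I then C (1 / (2 * R)) * (C R + C 1 * X i) else C (1 / 2)
  let w : Fin n → MvPolynomial (Fin n) ℝ := fun i => C (2 * R) * X i - C R
  have hinv : (C (2 * R) * C (1 / (2 * R)) : MvPolynomial (Fin n) ℝ) = 1 := by
    rw [← C_mul, mul_one_div_cancel (by positivity), C_1]
  have hcomp : aeval v (aeval w h) = h := by
    rw [← AlgHom.comp_apply, comp_aeval]
    refine aeval_eq_self_of_mem_supported hh fun i hi => ?_
    have hi' : i ∈ I := by simpa using hi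
    simp only [w, v, map_sub, map_mul, aeval_X, if_pos hi', algHom_C, algebraMap_eq, C_1]
    simp only [C_mul] at hinv
    linear_combination (C R + X i) * hinv
  rw [← hcomp]
  refine mem_subsemiring_of_pos_on_unitCube T hTC v (fun i => ?_) (fun i => ?_) _ (fun x hx => ?_)
  · by_cases hi : i ∈ I
    · simp only [v, if_pos hi]
      exact hlin i hi 1 (by norm_num)
    · simp only [v, if_neg hi]
      exact hTC _ (by norm_num)
  · by_cases hi : i ∈ I
    · simp only [v, if_pos hi]
      have := hlin i hi (-1) (by norm_num)
      convert this using 1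
      simp only [C_neg, C_1]
      simp only [C_mul] at hinv
      have h3 : (C (2 : ℝ) : MvPolynomial (Fin n) ℝ) = 2 := rfl
      rw [h3] at hinv
      linear_combination -hinv
    · simp only [v, if_neg hi]
      rw [← C_1, ← C_sub]
      exact hTC _ (by norm_num)
  · rw [eval_aeval_comp]
    simp only [w, map_sub, map_mul, eval_C, eval_X]
    refine hpos _ fun i => ⟨?_, ?_⟩ <;> nlinarith [(hx i).1, (hx i).2]

theorem one_sub_mul_pow_le {u : ℝ} (hu : 0 ≤ u) (hu1 : u ≤ 1) (k : ℕ) :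
    (1 - u) * u ^ k ≤ 1 / (k + 1) := by
  rw [le_div_iff₀ (by positivity)]
  have h : (k + 1 : ℝ) * u ^ k ≤ ∑ i ∈ Finset.range (k + 1), u ^ i := by
    have := Finset.card_nsmul_le_sum (Finset.range (k + 1)) (fun i => u ^ i) (u ^ k)
      (fun i hi => pow_le_pow_of_le_one hu hu1 (by simpa [Nat.lt_succ_iff] using hi))
    simpa using this
  have h2 := mul_neg_geom_sum u (k + 1)
  have h3 : 0 ≤ u ^ (k + 1) := by positivity
  nlinarith [mul_le_mul_of_nonneg_left h (sub_nonneg.2 hu1)]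

theorem max_neg_sub_le_neg_pow_mul {t : ℝ} (ht : t ≤ 1) (k : ℕ) :
    max (-t) 0 - 1 / (2 * k + 1) ≤ -((t - 1) ^ (2 * k) * t) := by
  have hk : (0 : ℝ) < 1 / (2 * k + 1) := by positivity
  rcases le_total t 0 with h | h
  · rw [max_eq_left (by linarith)]
    have : 1 ≤ (t - 1) ^ (2 * k) := by
      rw [pow_mul]
      exact one_le_pow₀ (by nlinarith)
    nlinarith
  · rw [max_eq_right (by linarith)]
    have h1 := one_sub_mul_pow_le (u := 1 - t) (by linarith) (by linarith) (2 * k)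
    have h2 : (t - 1) ^ (2 * k) = (1 - t) ^ (2 * k) := by
      rw [pow_mul, pow_mul]
      congr 1
      ring
    push_cast at h1
    rw [h2]
    linarith

theorem exists_penalty {E ι : Type*} [TopologicalSpace E] [Fintype ι] {B : Set E}
    (hB : IsCompact B) {f : E → ℝ} (hf : Continuous f) {g : ι → E → ℝ}
    (hg : ∀ j, Continuous (g j)) (hpos : ∀ x ∈ B, (∀ j, 0 ≤ g j x) → 0 < f x) :
    ∃ (a c : ℝ) (k : ℕ), 0 ≤ c ∧
      ∀ x ∈ B, 0 < f x - ∑ j, c * (a * g j x - 1) ^ (2 * k) * g j x := by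
  rcases B.eq_empty_or_nonempty with rfl | hne
  · exact ⟨0, 0, 0, le_rfl, by simp⟩
  obtain ⟨M, hM⟩ := hB.exists_bound_of_continuousOn
    (f := fun x => ∑ j, |g j x|) (by fun_prop)
  obtain ⟨F, hF⟩ := hB.exists_bound_of_continuousOn (f := f) hf.continuousOn
  obtain ⟨a, ha, hag⟩ : ∃ a : ℝ, 0 < a ∧ ∀ x ∈ B, ∀ j, a * g j x ≤ 1 := by
    have hM0 : 0 ≤ M := by
      obtain ⟨x, hx⟩ := hne
      exact (norm_nonneg _).trans (hM x hx)
    refine ⟨1 / (M + 1), by positivity, fun x hx j => ?_⟩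
    rw [one_div_mul_eq_div, div_le_one (by positivity)]
    have h1 := (Real.le_norm_self _).trans (hM x hx)
    have h2 := Finset.single_le_sum (f := fun j => |g j x|) (fun _ _ => abs_nonneg _)
      (Finset.mem_univ j)
    have h3 := le_abs_self (g j x)
    linarith
  have hψ : Continuous fun x => max (f x) 0 + ∑ j, max (-(a * g j x)) 0 := by fun_prop
  obtain ⟨x₀, hx₀, hmin⟩ := hB.exists_isMinOn hne hψ.continuousOn
  set η := max (f x₀) 0 + ∑ j, max (-(a * g j x₀)) 0 with hη
  have hsum0 (x : E) : 0 ≤ ∑ j, max (-(a * g j x)) 0 :=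
    Finset.sum_nonneg fun _ _ => le_max_right _ _
  have hη0 : 0 < η := by
    by_cases h : ∀ j, 0 ≤ g j x₀
    · have := hpos x₀ hx₀ h
      have h1 := hsum0 x₀
      have h2 := le_max_left (f x₀) 0
      linarith
    · push Not at h
      obtain ⟨j, hj⟩ := h
      have h1 := Finset.single_le_sum (f := fun j => max (-(a * g j x₀)) 0)
        (fun _ _ => le_max_right _ _) (Finset.mem_univ j)
      have h2 := le_max_left (-(a * g j x₀)) 0
      have h3 := le_max_right (f x₀) 0
      have h4 : a * g j x₀ < 0 := mul_neg_of_pos_of_neg ha hj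
      linarith
  have hF0 : 0 ≤ F := (norm_nonneg _).trans (hF x₀ hx₀)
  set c := 2 * (F + 1) / η with hc
  have hc0 : 0 < c := by positivity
  set δ := min (η / 2) 1 with hδ
  have hδ0 : 0 < δ := by positivity
  obtain ⟨k, hk⟩ := exists_nat_gt (c * Fintype.card ι / δ)
  have hsmall : c * (Fintype.card ι * (1 / (2 * (k : ℝ) + 1))) < δ := by
    rw [div_lt_iff₀ hδ0] at hk
    rw [← mul_assoc, mul_one_div, div_lt_iff₀ (by positivity)]
    nlinarith [(Nat.cast_nonneg k : (0 : ℝ) ≤ k)]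
  refine ⟨a, c * a, k, by positivity, fun x hx => ?_⟩
  have hlow : c * (∑ j, max (-(a * g j x)) 0) - c * (Fintype.card ι * (1 / (2 * (k : ℝ) + 1))) ≤
      -∑ j, c * a * (a * g j x - 1) ^ (2 * k) * g j x := by
    rw [← Finset.sum_neg_distrib, ← mul_sub]
    have : (Fintype.card ι * (1 / (2 * (k : ℝ) + 1))) = ∑ _j : ι, 1 / (2 * (k : ℝ) + 1) := by simp
    rw [this, ← Finset.sum_sub_distrib, Finset.mul_sum]
    refine Finset.sum_le_sum fun j _ => ?_
    have := mul_le_mul_of_nonneg_left (max_neg_sub_le_neg_pow_mul (hag x hx j) k) hc0.le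
    linarith
  have hm := hmin hx
  simp only [Set.mem_ofPred_eq] at hm
  have hfF := (abs_le.1 (hF x hx)).1
  by_cases hs : η / 2 ≤ ∑ j, max (-(a * g j x)) 0
  · have h1 := mul_le_mul_of_nonneg_left hs hc0.le
    have h2 : c * (η / 2) = F + 1 := by rw [hc]; field_simp
    have h3 : δ ≤ 1 := min_le_right _ _
    linarith
  · push Not at hs
    have h1 : η / 2 < max (f x) 0 := by linarith
    have h2 : η / 2 < f x := (lt_max_iff.1 h1).resolve_right (by linarith)
    have h3 : δ ≤ η / 2 := min_le_left _ _
    have h4 := mul_nonneg hc0.le (hsum0 x)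
    linarith

theorem exists_mvPolynomial_near {ι : Type*} {B : Set (ι → ℝ)} (hB : IsCompact B)
    {φ : (ι → ℝ) → ℝ} (hφ : Continuous φ) {ε : ℝ} (hε : 0 < ε) :
    ∃ q : MvPolynomial ι ℝ, ∀ x ∈ B, |eval x q - φ x| < ε := by
  let v : ι → C(ι → ℝ, ℝ) := fun i => ⟨fun x => x i, continuous_apply i⟩
  have hsep : (aeval v : MvPolynomial ι ℝ →ₐ[ℝ] C(ι → ℝ, ℝ)).range.SeparatesPoints := by
    intro x y hxy
    obtain ⟨i, hi⟩ := Function.ne_iff.1 hxy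
    exact ⟨v i, ⟨v i, ⟨X i, aeval_X v i⟩, rfl⟩, hi⟩
  obtain ⟨_, ⟨q, rfl⟩, hq⟩ :=
    ContinuousMap.exists_mem_subalgebra_near_continuous_of_isCompact_of_separatesPoints hsep
      ⟨φ, hφ⟩ hB hε
  refine ⟨q, fun x hx => ?_⟩
  have hev : (aeval v q : C(ι → ℝ, ℝ)) x = eval x q := by
    have : (ContinuousMap.evalAlgHom ℝ ℝ x).comp (aeval v) =
        (aeval x : MvPolynomial ι ℝ →ₐ[ℝ] ℝ) := by
      ext i
      simp [v]
    simpa [aeval_eq_eval] using DFunLike.congr_fun this q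
  have := hq x hx
  change |(aeval v q : C(ι → ℝ, ℝ)) x - φ x| < ε at this
  rwa [hev] at this

theorem exists_mvPolynomial_transfer {n : ℕ} {R : ℝ} (hR : 0 < R) {U I : Finset (Fin n)}
    {G P : MvPolynomial (Fin n) ℝ} (hG : G ∈ supported ℝ (U : Set (Fin n)))
    (hP : P ∈ supported ℝ (I : Set (Fin n)))
    (hpos : ∀ x : Fin n → ℝ, (∀ i, x i ∈ Set.Icc (-R) R) → 0 < eval x (G + P)) :
    ∃ q ∈ supported ℝ ((I ∩ U : Finset (Fin n)) : Set (Fin n)),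
      (∀ x : Fin n → ℝ, (∀ i, x i ∈ Set.Icc (-R) R) → 0 < eval x (G + q)) ∧
      ∀ x : Fin n → ℝ, (∀ i, x i ∈ Set.Icc (-R) R) → 0 < eval x (P - q) := by
  set B : Set (Fin n → ℝ) := Set.univ.pi fun _ => Set.Icc (-R) R with hBdef
  have hmemB (x : Fin n → ℝ) : x ∈ B ↔ ∀ i, x i ∈ Set.Icc (-R) R := by
    simp only [hBdef, Set.mem_pi, Set.mem_univ, forall_true_left]
  have hB : IsCompact B := isCompact_univ_pi fun _ => isCompact_Icc
  have h0 : (0 : ℝ) ∈ Set.Icc (-R) R := ⟨by linarith, hR.le⟩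
  have hne : B.Nonempty := ⟨fun _ => 0, (hmemB _).2 fun _ => h0⟩
  obtain ⟨x₀, hx₀, hmin⟩ := hB.exists_isMinOn hne (G + P).continuous_eval.continuousOn
  set ε := eval x₀ (G + P) / 3 with hε
  have hε0 : 0 < ε := div_pos (hpos x₀ ((hmemB _).1 hx₀)) (by norm_num)
  let mix : (Fin n → ℝ) → (Fin n → ℝ) → Fin n → ℝ := fun x z i => if i ∈ I ∩ U then x i else z i
  have hmix : Continuous fun xz : (Fin n → ℝ) × (Fin n → ℝ) => mix xz.1 xz.2 := by
    refine continuous_pi fun i => ?_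
    by_cases hi : i ∈ I ∩ U
    · simp only [mix, if_pos hi]
      fun_prop
    · simp only [mix, if_neg hi]
      fun_prop
  have hmixB {x z : Fin n → ℝ} (hx : x ∈ B) (hz : z ∈ B) : mix x z ∈ B := by
    refine (hmemB _).2 fun i => ?_
    simp only [mix]
    split_ifs
    exacts [(hmemB _).1 hx i, (hmemB _).1 hz i]
  let φ : (Fin n → ℝ) → ℝ := fun x => sInf ((fun z => eval (mix x z) P) '' B)
  have hcont : Continuous fun xz : (Fin n → ℝ) × (Fin n → ℝ) => eval (mix xz.1 xz.2) P :=
    P.continuous_eval.comp hmix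
  have hφ : Continuous φ :=
    hB.continuous_sInf (f := fun x z => eval (mix x z) P) hcont
  have hslice (x : Fin n → ℝ) : Continuous fun z => eval (mix x z) P :=
    P.continuous_eval.comp (hmix.comp (Continuous.prodMk_right x))
  have hφle {x z : Fin n → ℝ} (hz : z ∈ B) : φ x ≤ eval (mix x z) P :=
    csInf_le (hB.image (hslice x)).bddBelow ⟨z, hz, rfl⟩
  have hφmem (x : Fin n → ℝ) : ∃ z ∈ B, eval (mix x z) P = φ x :=
    (hB.image (hslice x)).sInf_mem (hne.image _)
  obtain ⟨q, hq⟩ := exists_mvPolynomial_near hB (φ := fun x => φ x - 3 / 2 * ε) (by fun_prop) hε0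
  let proj : Fin n → MvPolynomial (Fin n) ℝ := fun i => if i ∈ I ∩ U then X i else 0
  have hqeval (x : Fin n → ℝ) : eval x (aeval proj q) = eval (mix x fun _ => 0) q := by
    rw [eval_aeval_comp]
    refine congrArg (fun y => eval y q) (funext fun i => ?_)
    by_cases hi : i ∈ I ∩ U
    · simp only [proj, mix, if_pos hi, eval_X]
    · simp only [proj, mix, if_neg hi, map_zero]
  have hφmix (x : Fin n → ℝ) : φ (mix x fun _ => 0) = φ x := by
    have : ∀ z, mix (mix x fun _ => 0) z = mix x z := by
      intro z
      ext i
      simp only [mix]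
      split_ifs <;> rfl
    simp only [φ, this]
  have hqnear {x : Fin n → ℝ} (hx : x ∈ B) :
      |eval x (aeval proj q) - (φ x - 3 / 2 * ε)| < ε := by
    rw [hqeval, ← hφmix x]
    exact hq _ (hmixB hx ((hmemB _).2 fun _ => h0))
  refine ⟨aeval proj q, ?_, fun x hx => ?_, fun x hx => ?_⟩
  · have : (aeval proj q : MvPolynomial (Fin n) ℝ) ∈
        (aeval proj : MvPolynomial (Fin n) ℝ →ₐ[ℝ] _).range := ⟨q, rfl⟩
    rw [← Algebra.adjoin_range_eq_range_aeval] at this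
    refine Algebra.adjoin_le ?_ this
    rintro _ ⟨i, rfl⟩
    by_cases hi : i ∈ I ∩ U
    · simp only [proj, if_pos hi]
      exact X_mem_supported.2 (Finset.mem_coe.2 hi)
    · simp only [proj, if_neg hi]
      exact zero_mem _
  · have hxB := (hmemB x).2 hx
    obtain ⟨z, hz, hzφ⟩ := hφmem x
    let y : Fin n → ℝ := fun i => if i ∈ U then x i else z i
    have hyB : y ∈ B := by
      refine (hmemB _).2 fun i => ?_
      simp only [y]
      split_ifs
      exacts [hx i, (hmemB _).1 hz i]
    have hyG : eval y G = eval x G := eval_congr_of_mem_supported hG fun i hi => by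
      simp only [y, if_pos (Finset.mem_coe.1 hi)]
    have hyP : eval y P = eval (mix x z) P := eval_congr_of_mem_supported hP fun i hi => by
      simp [y, mix, Finset.mem_coe.1 hi]
    have h1 := hmin hyB
    have h2 := (abs_lt.1 (hqnear hxB)).1
    simp only [Set.mem_ofPred_eq] at h1
    rw [map_add (eval y), hyG, hyP, hzφ] at h1
    rw [map_add]
    linarith
  · have hxB := (hmemB x).2 hx
    have h1 := hφle (x := x) hxB
    have h2 := (abs_lt.1 (hqnear hxB)).2
    have h3 : mix x x = x := by
      ext i
      simp [mix]
    rw [h3] at h1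
    rw [map_sub]
    linarith

theorem exists_pos_decomposition {n : ℕ} {R : ℝ} (hR : 0 < R) : ∀ {p : ℕ}
    {I : Fin p → Finset (Fin n)}, RIPFinset I → ∀ {F : Fin p → MvPolynomial (Fin n) ℝ},
    (∀ k, F k ∈ supported ℝ (I k : Set (Fin n))) →
    (∀ x : Fin n → ℝ, (∀ i, x i ∈ Set.Icc (-R) R) → 0 < eval x (∑ k, F k)) →
    ∃ H : Fin p → MvPolynomial (Fin n) ℝ, (∀ k, H k ∈ supported ℝ (I k : Set (Fin n))) ∧
      ∑ k, H k = ∑ k, F k ∧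
      ∀ k, ∀ x : Fin n → ℝ, (∀ i, x i ∈ Set.Icc (-R) R) → 0 < eval x (H k)
  | 0, _, _, F, _, _ => ⟨F, fun k => k.elim0, rfl, fun k => k.elim0⟩
  | 1, _, _, F, hF, hpos => ⟨F, hF, rfl, fun k => by simpa [Subsingleton.elim k 0] using hpos⟩
  | p + 2, I, hI, F, hF, hpos => by
    obtain ⟨l, hl, hsub⟩ := hI p (by omega)
    set U := (Finset.univ.filter (fun j : Fin (p + 2) => (j : ℕ) ≤ p)).biUnion I with hU
    have hIU (k : Fin (p + 1)) : I k.castSucc ⊆ U :=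
      Finset.subset_biUnion_of_mem I (by simp; omega)
    have hG : ∑ k : Fin (p + 1), F k.castSucc ∈ supported ℝ (U : Set (Fin n)) :=
      sum_mem fun k _ => supported_mono (Finset.coe_subset.2 (hIU k)) (hF _)
    rw [Fin.sum_univ_castSucc] at hpos
    obtain ⟨q, hq, hqG, hqP⟩ := exists_mvPolynomial_transfer hR hG (hF (Fin.last _)) hpos
    have hsub' : I (Fin.last _) ∩ U ⊆ I l := hsub
    let l' : Fin (p + 1) := ⟨l, by omega⟩
    have hl' : l'.castSucc = l := rfl
    have hsum : ∑ k : Fin (p + 1), (F k.castSucc + if k = l' then q else 0) =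
        ∑ k : Fin (p + 1), F k.castSucc + q := by
      simp [Finset.sum_add_distrib]
    have hI' : RIPFinset fun k : Fin (p + 1) => I k.castSucc := by
      intro k hk
      obtain ⟨m, hm, hms⟩ := hI k (by omega)
      refine ⟨⟨m, by omega⟩, hm, fun i hi => hms ?_⟩
      simp only [Finset.mem_inter, Finset.mem_biUnion, Finset.mem_filter, Finset.mem_univ,
        true_and] at hi ⊢
      obtain ⟨hi1, j, hj, hij⟩ := hi
      exact ⟨hi1, j.castSucc, hj, hij⟩
    obtain ⟨H, hHs, hHsum, hHpos⟩ := exists_pos_decomposition hR hI'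
      (F := fun k => F k.castSucc + if k = l' then q else 0) (fun k => by
        refine add_mem (hF _) ?_
        split_ifs with h
        · rw [h, hl']
          exact supported_mono (Finset.coe_subset.2 hsub') hq
        · exact zero_mem _) (by rwa [hsum])
    refine ⟨Fin.snoc H (F (Fin.last _) - q), fun k => ?_, ?_, fun k => ?_⟩
    · refine Fin.lastCases ?_ (fun k => ?_) k
      · rw [Fin.snoc_last]
        exact sub_mem (hF _) (supported_mono (Finset.coe_subset.2 Finset.inter_subset_left) hq)
      · rw [Fin.snoc_castSucc]
        exact hHs k
    · rw [Fin.sum_univ_castSucc, Fin.sum_univ_castSucc (f := F)]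
      simp only [Fin.snoc_last, Fin.snoc_castSucc]
      rw [hHsum, hsum]
      ring
    · refine Fin.lastCases ?_ (fun k => ?_) k
      · rw [Fin.snoc_last]
        exact hqP
      · rw [Fin.snoc_castSucc]
        exact hHpos k

theorem exists_sparse_representation {n m p : ℕ} {g : Fin m → MvPolynomial (Fin n) ℝ}
    {I : Fin p → Finset (Fin n)} {F : Fin p → MvPolynomial (Fin n) ℝ}
    (hF : ∀ k, F k ∈ supported ℝ (I k : Set (Fin n))) {J : Fin p → Finset (Fin m)}
    (hJdisj : ∀ k l, k ≠ l → Disjoint (J k) (J l)) (hJcover : ∀ j : Fin m, ∃ k, j ∈ J k)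
    (hg : ∀ k, ∀ j ∈ J k, g j ∈ supported ℝ (I k : Set (Fin n))) (hRIP : RIPFinset I)
    (hball : ∀ k, ∃ N : ℝ, 0 < N ∧ ∃ j ∈ J k, g j = C N - ∑ i ∈ I k, X i ^ 2)
    (hpos : ∀ x : Fin n → ℝ, (∀ j, 0 ≤ eval x (g j)) → 0 < eval x (∑ k, F k)) :
    ∃ (σ0 : Fin p → MvPolynomial (Fin n) ℝ) (σ : Fin p → Fin m → MvPolynomial (Fin n) ℝ),
      (∀ k, IsSOSSupported (I k : Set (Fin n)) (σ0 k)) ∧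
      (∀ k, ∀ j ∈ J k, IsSOSSupported (I k : Set (Fin n)) (σ k j)) ∧
      ∑ k, F k = ∑ k, (σ0 k + ∑ j ∈ J k, σ k j * g j) := by
  choose N hN b hbJ hb using hball
  set R : ℝ := 1 + ∑ k, N k with hRdef
  have hsum0 : 0 ≤ ∑ k, N k := Finset.sum_nonneg fun k _ => (hN k).le
  have hR : 0 < R := by linarith
  have hNR (k : Fin p) : N k ≤ R ^ 2 := by
    have h1 : N k ≤ ∑ k, N k := Finset.single_le_sum (fun k _ => (hN k).le) (Finset.mem_univ k)
    nlinarith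
  obtain ⟨a, c, d, hc, hpen⟩ := exists_penalty
    (B := Set.univ.pi fun _ : Fin n => Set.Icc (-R) R) (isCompact_univ_pi fun _ => isCompact_Icc)
    (∑ k, F k).continuous_eval (fun j => (g j).continuous_eval) (fun x _ hx => hpos x hx)
  let ρ : Fin m → MvPolynomial (Fin n) ℝ := fun j => C c * (C a * g j - 1) ^ (2 * d)
  have hρ (k : Fin p) (j : Fin m) (hj : j ∈ J k) : IsSOSSupported (I k : Set (Fin n)) (ρ j) := by
    refine (IsSOSSupported.const hc).mul ?_
    rw [mul_comm 2 d, pow_mul]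
    exact .sq (pow_mem (sub_mem (mul_mem (Subalgebra.algebraMap_mem _ a) (hg k j hj))
      (one_mem _)) _)
  have hρs (k : Fin p) (j : Fin m) (hj : j ∈ J k) : ρ j ∈ supported ℝ (I k : Set (Fin n)) :=
    mul_mem (Subalgebra.algebraMap_mem _ c) (pow_mem (sub_mem
      (mul_mem (Subalgebra.algebraMap_mem _ a) (hg k j hj)) (one_mem _)) _)
  have hpart : ∑ k, ∑ j ∈ J k, ρ j * g j = ∑ j, ρ j * g j := by
    rw [← Finset.sum_biUnion fun k _ l _ hkl => hJdisj k l hkl]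
    refine Finset.sum_congr (Finset.eq_univ_of_forall fun j => ?_) fun _ _ => rfl
    obtain ⟨k, hk⟩ := hJcover j
    exact Finset.mem_biUnion.2 ⟨k, Finset.mem_univ k, hk⟩
  obtain ⟨H, hHs, hHsum, hHpos⟩ := exists_pos_decomposition hR hRIP
    (F := fun k => F k - ∑ j ∈ J k, ρ j * g j)
    (fun k => sub_mem (hF k) (sum_mem fun j hj => mul_mem (hρs k j hj) (hg k j hj)))
    (fun x hx => by
      rw [Finset.sum_sub_distrib, hpart, map_sub, map_sum (eval x) (fun j => ρ j * g j)]
      have := hpen x fun i _ => hx i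
      simpa [ρ] using this)
  choose a' b' ha' hb' hH using fun k => exists_ball_representation (I k) hR (hNR k) (hHs k)
    (hHpos k)
  refine ⟨a', fun k j => ρ j + if j = b k then b' k else 0, ha', fun k j hj => ?_, ?_⟩
  · refine (hρ k j hj).add ?_
    split_ifs
    exacts [hb' k, .zero]
  · have h1 : ∑ k, F k = ∑ k, (H k + ∑ j ∈ J k, ρ j * g j) := by
      rw [Finset.sum_add_distrib, hHsum, Finset.sum_sub_distrib, sub_add_cancel]
    rw [h1]
    refine Finset.sum_congr rfl fun k _ => ?_
    simp only [add_mul, ite_mul, zero_mul, Finset.sum_add_distrib, Finset.sum_ite_eq', hbJ, if_true]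
    rw [hb k]
    linear_combination hH k

/-- The character `z ↦ (-1) ^ z` of `ZMod 2`, with real values. -/
def signChar (z : ZMod 2) : ℝ := if z = 0 then 1 else -1

theorem signChar_add (z w : ZMod 2) : signChar (z + w) = signChar z * signChar w := by
  have h (z : ZMod 2) : z = 0 ∨ z = 1 := by
    revert z
    decide
  have h2 : (1 + 1 : ZMod 2) = 0 := by decide
  rcases h z with rfl | rfl <;> rcases h w with rfl | rfl <;> simp [signChar, h2]

theorem signChar_mul_natCast (z : ZMod 2) (a : ℕ) : signChar (z * a) = signChar z ^ a := by
  induction a with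
  | zero => simp [signChar]
  | succ a ih => rw [Nat.cast_succ, mul_add, mul_one, signChar_add, ih, pow_succ]

theorem signChar_sum {ι : Type*} (t : Finset ι) (z : ι → ZMod 2) :
    signChar (∑ i ∈ t, z i) = ∏ i ∈ t, signChar (z i) := by
  classical
  induction t using Finset.induction_on with
  | empty => simp [signChar]
  | insert i t hi ih => rw [Finset.sum_insert hi, Finset.prod_insert hi, signChar_add, ih]

/-- The substitution `xᵢ ↦ (-1) ^ sᵢ xᵢ`. -/
noncomputable def signFlip {n : ℕ} (s : Fin n → ZMod 2) :
    MvPolynomial (Fin n) ℝ →ₐ[ℝ] MvPolynomial (Fin n) ℝ :=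
  aeval fun i => C (signChar (s i)) * X i

theorem coeff_signFlip {n : ℕ} (s : Fin n → ZMod 2) (q : MvPolynomial (Fin n) ℝ)
    (α : Fin n →₀ ℕ) :
    coeff α (signFlip s q) = signChar (∑ i, s i * (α i : ZMod 2)) * coeff α q := by
  induction q using MvPolynomial.induction_on' with
  | add p q hp hq => rw [map_add, coeff_add, coeff_add, hp, hq, mul_add]
  | monomial β c =>
    have h : signFlip s (monomial β c) =
        monomial β (c * ∏ i, signChar (s i) ^ β i) := by
      rw [signFlip, aeval_monomial, Finsupp.prod_fintype _ _ (fun i => pow_zero _), monomial_eq,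
        Finsupp.prod_fintype _ _ (fun i => pow_zero _), C_mul, map_prod, algebraMap_eq]
      simp only [mul_pow, Finset.prod_mul_distrib, map_pow, mul_assoc]
    rw [h, coeff_monomial, coeff_monomial]
    split_ifs with hβ
    · subst hβ
      rw [signChar_sum]
      simp only [signChar_mul_natCast]
      ring
    · simp

/-- The average of a polynomial over a finite set of sign changes of the variables. -/
noncomputable def signAverage {n : ℕ} (S : Finset (Fin n → ZMod 2))
    (q : MvPolynomial (Fin n) ℝ) : MvPolynomial (Fin n) ℝ :=
  C ((S.card : ℝ)⁻¹) * ∑ s ∈ S, signFlip s q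

theorem IsSOSSupported.signAverage {n : ℕ} {I : Set (Fin n)} {q : MvPolynomial (Fin n) ℝ}
    (hq : IsSOSSupported I q) (S : Finset (Fin n → ZMod 2)) :
    IsSOSSupported I (signAverage S q) :=
  (IsSOSSupported.const (by positivity)).mul <| .sum fun s _ => hq.map _ fun i hi => by
    rw [signFlip, aeval_X]
    exact mul_mem (Subalgebra.algebraMap_mem _ _) (X_mem_supported.2 hi)

theorem signFlip_eq_self {n : ℕ} {s : Fin n → ZMod 2} {q : MvPolynomial (Fin n) ℝ}
    (hq : ∀ α ∈ q.support, ∑ i, s i * (α i : ZMod 2) = 0) : signFlip s q = q := by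
  ext α
  rw [coeff_signFlip]
  by_cases hα : α ∈ q.support
  · rw [hq α hα]
    simp [signChar]
  · rw [notMem_support_iff.1 hα, mul_zero]

theorem signAverage_add {n : ℕ} (S : Finset (Fin n → ZMod 2)) (q r : MvPolynomial (Fin n) ℝ) :
    signAverage S (q + r) = signAverage S q + signAverage S r := by
  simp only [signAverage, map_add, Finset.sum_add_distrib, mul_add]

theorem signAverage_sum {n : ℕ} (S : Finset (Fin n → ZMod 2)) {ι : Type*} (t : Finset ι)
    (q : ι → MvPolynomial (Fin n) ℝ) :
    signAverage S (∑ i ∈ t, q i) = ∑ i ∈ t, signAverage S (q i) := by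
  simp only [signAverage, map_sum]
  rw [Finset.sum_comm, Finset.mul_sum]

theorem signAverage_mul_of_invariant {n : ℕ} {S : Finset (Fin n → ZMod 2)}
    (q : MvPolynomial (Fin n) ℝ) {g : MvPolynomial (Fin n) ℝ} (hg : ∀ s ∈ S, signFlip s g = g) :
    signAverage S (q * g) = signAverage S q * g := by
  rw [signAverage, signAverage, mul_assoc, Finset.sum_mul]
  congr 1
  exact Finset.sum_congr rfl fun s hs => by rw [map_mul, hg s hs]

theorem signAverage_eq_self {n : ℕ} {S : Finset (Fin n → ZMod 2)} (hS : S.Nonempty)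
    {g : MvPolynomial (Fin n) ℝ} (hg : ∀ s ∈ S, signFlip s g = g) : signAverage S g = g := by
  have hcard : (S.card : ℝ) ≠ 0 := by exact_mod_cast hS.card_pos.ne'
  rw [signAverage, Finset.sum_congr rfl hg, Finset.sum_const, nsmul_eq_mul, ← mul_assoc,
    ← C_eq_coe_nat, ← C_mul, inv_mul_cancel₀ hcard, C_1, one_mul]

theorem sum_mul_eq_zero_of_mem_support_signAverage {n : ℕ} {S : Finset (Fin n → ZMod 2)}
    (hS : ∀ s ∈ S, ∀ t ∈ S, t + s ∈ S) {q : MvPolynomial (Fin n) ℝ} {α : Fin n →₀ ℕ}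
    (hα : α ∈ (signAverage S q).support) {s : Fin n → ZMod 2} (hs : s ∈ S) :
    ∑ i, s i * (α i : ZMod 2) = 0 := by
  by_contra hne
  refine mem_support_iff.1 hα ?_
  rw [signAverage, coeff_C_mul, coeff_sum]
  simp only [coeff_signFlip]
  rw [← Finset.sum_mul]
  have hss (t : Fin n → ZMod 2) : t + s + s = t := by
    ext i
    simp [add_assoc, CharTwo.add_self_eq_zero]
  have hflip : ∑ t ∈ S, signChar (∑ i, t i * (α i : ZMod 2)) =
      ∑ t ∈ S, signChar (∑ i, (t + s) i * (α i : ZMod 2)) :=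
    Finset.sum_nbij' (· + s) (· + s) (fun t ht => hS s hs t ht) (fun t ht => hS s hs t ht)
      (fun t _ => hss t) (fun t _ => hss t) (fun t _ => by simp only [hss])
  have hneg : signChar (∑ i, s i * (α i : ZMod 2)) = -1 := if_neg hne
  simp only [Pi.add_apply, add_mul, Finset.sum_add_distrib, signChar_add, hneg, mul_neg, mul_one,
    Finset.sum_neg_distrib] at hflip
  rw [self_eq_neg.1 hflip, zero_mul, mul_zero]

/-- **Sparse representation adapted to both correlative sparsity and sign symmetries**: under
the correlative sparsity assumptions with running intersection property and ball constraints,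
every polynomial positive on `X` admits a representation
`f = Σ_k (σ_{k,0} + Σ_{j∈J_k} σ_{k,j}·g_j)` with `σ_{k,0}, σ_{k,j} ∈ Σ[x,I_k]` whose supports
are annihilated (mod 2) by every sign symmetry of `A = supp f ∪ ⋃_j supp g_j`. -/
theorem cs_sign_symmetry_representation (n m p : ℕ)
    (f : MvPolynomial (Fin n) ℝ) (g : Fin m → MvPolynomial (Fin n) ℝ)
    (K : Set (Fin n → ℝ)) (hK : K = {x | ∀ j, 0 ≤ eval x (g j)})
    (I : Fin p → Finset (Fin n)) (hcover : ∀ i : Fin n, ∃ k, i ∈ I k)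
    (fk : Fin p → MvPolynomial (Fin n) ℝ)
    (hfsum : f = ∑ k, fk k)
    (hfksupp : ∀ k, fk k ∈ MvPolynomial.supported ℝ ((I k : Finset (Fin n)) : Set (Fin n)))
    (J : Fin p → Finset (Fin m))
    (hJdisj : ∀ k l, k ≠ l → Disjoint (J k) (J l))
    (hJcover : ∀ j : Fin m, ∃ k, j ∈ J k)
    (hgsupp : ∀ k, ∀ j ∈ J k,
      g j ∈ MvPolynomial.supported ℝ ((I k : Finset (Fin n)) : Set (Fin n)))
    (hRIP : RIPFinset I)
    (hball : ∀ k, ∃ N : ℝ, 0 < N ∧ ∃ j ∈ J k, g j = C N - ∑ i ∈ I k, X i ^ 2)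
    (hfpos : ∀ x ∈ K, 0 < eval x f) :
    ∃ (σ0 : Fin p → MvPolynomial (Fin n) ℝ)
      (σ : Fin p → Fin m → MvPolynomial (Fin n) ℝ),
      (∀ k, IsSOSSupported ((I k : Finset (Fin n)) : Set (Fin n)) (σ0 k)) ∧
      (∀ k, ∀ j ∈ J k, IsSOSSupported ((I k : Finset (Fin n)) : Set (Fin n)) (σ k j)) ∧
      f = ∑ k, (σ0 k + ∑ j ∈ J k, σ k j * g j) ∧
      ∀ s : Fin n → ZMod 2,
        (∀ α : Fin n →₀ ℕ, (α ∈ f.support ∨ ∃ j, α ∈ (g j).support) →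
          ∑ i, s i * (α i : ZMod 2) = 0) →
        (∀ k, ∀ α ∈ (σ0 k).support, ∑ i, s i * (α i : ZMod 2) = 0) ∧
        ∀ k, ∀ j ∈ J k, ∀ α ∈ (σ k j).support, ∑ i, s i * (α i : ZMod 2) = 0 := by
  classical
  subst hK hfsum
  obtain ⟨σ0, σ, hσ0, hσ, hrep⟩ := exists_sparse_representation hfksupp hJdisj hJcover hgsupp
    hRIP hball hfpos
  set f := ∑ k, fk k with hf
  let S : Finset (Fin n → ZMod 2) := Finset.univ.filter fun s =>
    ∀ α : Fin n →₀ ℕ, (α ∈ f.support ∨ ∃ j, α ∈ (g j).support) → ∑ i, s i * (α i : ZMod 2) = 0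
  have hmem (s : Fin n → ZMod 2) : s ∈ S ↔ ∀ α : Fin n →₀ ℕ,
      (α ∈ f.support ∨ ∃ j, α ∈ (g j).support) → ∑ i, s i * (α i : ZMod 2) = 0 := by
    simp only [S, Finset.mem_filter, Finset.mem_univ, true_and]
  have hne : S.Nonempty := ⟨0, (hmem 0).2 fun α _ => by simp⟩
  have hadd : ∀ s ∈ S, ∀ t ∈ S, t + s ∈ S := fun s hs t ht => (hmem _).2 fun α hα => by
    simp only [Pi.add_apply, add_mul, Finset.sum_add_distrib, (hmem s).1 hs α hα,
      (hmem t).1 ht α hα, add_zero]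
  have hfS : ∀ s ∈ S, signFlip s f = f := fun s hs =>
    signFlip_eq_self fun α hα => (hmem s).1 hs α (.inl hα)
  have hgS (j : Fin m) : ∀ s ∈ S, signFlip s (g j) = g j := fun s hs =>
    signFlip_eq_self fun α hα => (hmem s).1 hs α (.inr ⟨j, hα⟩)
  refine ⟨fun k => signAverage S (σ0 k), fun k j => signAverage S (σ k j),
    fun k => (hσ0 k).signAverage S, fun k j hj => (hσ k j hj).signAverage S, ?_, fun s hs => ?_⟩
  · conv_lhs => rw [← signAverage_eq_self hne hfS, hrep]
    simp only [signAverage_sum, signAverage_add, signAverage_mul_of_invariant _ (hgS _)]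
  · have hsS := (hmem s).2 hs
    exact ⟨fun k α hα => sum_mul_eq_zero_of_mem_support_signAverage hadd hα hsS,
      fun k j _ α hα => sum_mul_eq_zero_of_mem_support_signAverage hadd hα hsS⟩
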